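/- Let F be a field, D a subring of F, and let X and Y be projective models of F/D such that Y dominates X, i.e. each local ring in Y dominates some local ring in X. Then the map d_{Y,X} : Y → X that sends a local ring α in Y to the unique local ring in X that α dominates is surjective, closed and continuous in both the Zariski and patch topologies, and d_{Y,X} ∘ d_Y = d_X, where d_X and d_Y are the domination maps from Zar_F(D) to X and Y respectively. -/

import Mathlib

/-!
Common definitions: valuation rings of a field, the Zariski--Riemann space
`Zar_F(D)` with its Zariski and patch topologies, domination of local subrings,
residual algebraicity, integral closedness, and projective models of `F/D`.
-/

variable {F : Type*} [Field F]

/-- `x` lies in the maximal ideal (set of nonunits) of the (local) subring `R` of `F`. -/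
def MemMaxIdeal (R : Subring F) (x : F) : Prop :=
  ∃ h : x ∈ R, ¬ IsUnit (⟨x, h⟩ : R)

/-- The local ring `R` dominates the local ring `S` (both subrings of `F`):
`S ⊆ R` and the maximal ideal of `R` contracts to the maximal ideal of `S`. -/
def Dominates (R S : Subring F) : Prop :=
  S ≤ R ∧ ∀ x ∈ S, (MemMaxIdeal S x ↔ MemMaxIdeal R x)

/-- `V` is a valuation ring of the field `F`: for every nonzero `x ∈ F`,
`x ∈ V` or `x⁻¹ ∈ V`. -/
def IsValSubring (V : Subring F) : Prop :=
  ∀ x : F, x ≠ 0 → x ∈ V ∨ x⁻¹ ∈ V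

/-- `Zar_F(D)`: the valuation rings of `F` containing `D`. -/
def zarSet (D : Subring F) : Set (Subring F) :=
  {V | IsValSubring V ∧ D ≤ V}

/-- `Dom_F(D)`: the valuation rings of `F` dominating the local subring `D`. -/
def domSet (D : Subring F) : Set (Subring F) :=
  {V | IsValSubring V ∧ Dominates V D}

/-- The Zariski topology on a collection `X` of subrings of `F`, with basic open sets
`U(x₁,…,xₙ) = {R ∈ X : x₁,…,xₙ ∈ R}`. -/
def zariskiTop (X : Set (Subring F)) : TopologicalSpace X :=
  TopologicalSpace.generateFrom
    {U | ∃ s : Finset F, U = {R : X | ∀ x ∈ s, x ∈ (R : Subring F)}}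

/-- The patch topology on a collection `X` of subrings of `F`: generated by the
quasicompact Zariski-open sets together with their complements. -/
def patchTop (X : Set (Subring F)) : TopologicalSpace X :=
  TopologicalSpace.generateFrom
    ({U | @IsOpen _ (zariskiTop X) U ∧ @IsCompact _ (zariskiTop X) U} ∪
      {V | ∃ U, @IsOpen _ (zariskiTop X) U ∧ @IsCompact _ (zariskiTop X) U ∧ V = Uᶜ})

/-- `R` is residually algebraic over `D`: the residue field extension
`D/m_D → R/m_R` is algebraic, i.e. each element of `R` satisfies, modulo the
maximal ideal of `R`, a monic polynomial with coefficients in `D`. -/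
def ResiduallyAlgebraic (D R : Subring F) : Prop :=
  ∀ x ∈ R, ∃ p : Polynomial F, p.Monic ∧ (∀ i, p.coeff i ∈ D) ∧ MemMaxIdeal R (p.eval x)

/-- `R` is integrally closed in `F`: every element of `F` integral over `R` lies in `R`. -/
def IntegrallyClosedIn (R : Subring F) : Prop :=
  ∀ x : F, (∃ p : Polynomial F, p.Monic ∧ (∀ i, p.coeff i ∈ R) ∧ p.eval x = 0) → x ∈ R

/-- The localization of the subring `A` of `F` at the prime ideal `P`, viewed as the
subring of `F` generated by the fractions `a/b` with `a, b ∈ A`, `b ∉ P`. -/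
def localizationSubring (A : Subring F) (P : Ideal A) : Subring F :=
  Subring.closure {z : F | ∃ a b : A, b ∉ P ∧ z = (a : F) * (b : F)⁻¹}

/-- The ring `D[x₁/xᵢ, …, xₙ/xᵢ]`. -/
def modelChart (D : Subring F) {n : ℕ} (x : Fin n → F) (i : Fin n) : Subring F :=
  Subring.closure ((D : Set F) ∪ {y | ∃ j, y = x j * (x i)⁻¹})

/-- `X` is the projective model of `F/D` defined by some nonzero elements
`x₀, …, xₙ` of `F`: the set of all localizations of the rings
`D[x₀/xᵢ, …, xₙ/xᵢ]` at their prime ideals. -/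
def IsProjModel (D : Subring F) (X : Set (Subring F)) : Prop :=
  ∃ (n : ℕ) (x : Fin (n + 1) → F), (∀ i, x i ≠ 0) ∧
    X = {R | ∃ (i : Fin (n + 1)) (P : Ideal (modelChart D x i)),
          P.IsPrime ∧ R = localizationSubring (modelChart D x i) P}

/-- `X(Z)`: the members of the projective model `X` dominated by some valuation ring
in `Z`. -/
def modelImage (X Z : Set (Subring F)) : Set (Subring F) :=
  {α ∈ X | ∃ V ∈ Z, Dominates V α}

/-- `A(Y)`: the intersection of a collection `Y` of subrings of `F`, as a subset of `F`. -/
def ringsInter (Y : Set (Subring F)) : Set F :=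
  ⋂ R ∈ Y, (R : Set F)

open scoped Topology

theorem memMaxIdeal_iff (R : Subring F) (x : F) :
    MemMaxIdeal R x ↔ x ∈ R ∧ (x = 0 ∨ x⁻¹ ∉ R) := by
  constructor
  · rintro ⟨h, hu⟩
    refine ⟨h, ?_⟩
    by_contra! hc
    exact hu (IsUnit.of_mul_eq_one ⟨x⁻¹, hc.2⟩ (Subtype.ext (mul_inv_cancel₀ hc.1)))
  · rintro ⟨h, hx⟩
    refine ⟨h, fun hu => ?_⟩
    obtain ⟨y, hy⟩ := hu.exists_right_inv
    have hxy : x * y = 1 := congrArg Subtype.val hy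
    have hx0 : x ≠ 0 := left_ne_zero_of_mul_eq_one hxy
    refine hx.elim hx0 fun hi => hi ?_
    rw [← eq_inv_of_mul_eq_one_right hxy]
    exact y.2

theorem Dominates.trans {R S T : Subring F} (h₁ : Dominates R S) (h₂ : Dominates S T) :
    Dominates R T :=
  ⟨h₂.1.trans h₁.1, fun x hx => (h₂.2 x hx).trans (h₁.2 x (h₂.1 hx))⟩

theorem Dominates.inv_mem {R S : Subring F} (h : Dominates R S) {x : F} (hx : x ∈ S)
    (hi : x⁻¹ ∈ R) : x⁻¹ ∈ S := by
  by_contra hc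
  obtain ⟨_, h0 | h0⟩ :=
    (memMaxIdeal_iff R x).1 ((h.2 x hx).1 ((memMaxIdeal_iff S x).2 ⟨hx, Or.inr hc⟩))
  · exact hc (by simp [h0])
  · exact h0 hi

/-- A local subring of a valuation ring `V` is dominated by a valuation ring inside `V`. -/
theorem exists_le_dominates {A V : Subring F} [IsLocalRing A] (hV : IsValSubring V)
    (hAV : A ≤ V) : ∃ W : Subring F, IsValSubring W ∧ W ≤ V ∧ Dominates W A := by
  let V' : ValuationSubring F := ⟨V, fun x => by
    rcases eq_or_ne x 0 with rfl | hx
    · exact Or.inl V.zero_mem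
    · exact hV x hx⟩
  let r : V' →+* IsLocalRing.ResidueField V' := IsLocalRing.residue V'
  let ι : A →+* V' := Subring.inclusion (show A ≤ V'.toSubring from hAV)
  obtain ⟨B, hB, hloc⟩ := IsLocalRing.exists_factor_valuationRing (r.comp ι)
  let W : Subring F := (B.toSubring.comap r).map V'.subtype
  have hW : ∀ x : V', (x : F) ∈ W ↔ r x ∈ B := by
    intro x
    constructor
    · rintro ⟨y, hy, hyx⟩
      obtain rfl : y = x := Subtype.ext hyx
      exact hy
    · exact fun hx => ⟨x, hx, rfl⟩
  have hWV : W ≤ V := by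
    rintro _ ⟨y, _, rfl⟩
    exact y.2
  have hAW : A ≤ W := fun x hx => (hW (ι ⟨x, hx⟩)).2 (hB ⟨x, hx⟩)
  have hnonunit : ∀ x : V', (x : F)⁻¹ ∉ V → r x = 0 := by
    intro x hx
    refine (IsLocalRing.residue_eq_zero_iff x).2 ?_
    rw [IsLocalRing.mem_maximalIdeal, mem_nonunits_iff]
    exact ((memMaxIdeal_iff V x).2 ⟨x.2, Or.inr hx⟩).2
  refine ⟨W, ?_, hWV, hAW, ?_⟩
  · have key : ∀ x : F, x ∈ V → x ∈ W ∨ x⁻¹ ∈ W := by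
      intro x hx
      by_cases hi : x⁻¹ ∈ V
      · rcases eq_or_ne x 0 with rfl | hx0
        · exact Or.inl W.zero_mem
        have hmul : r ⟨x, hx⟩ * r ⟨x⁻¹, hi⟩ = 1 := by
          rw [← map_mul, ← map_one r]
          exact congrArg r (Subtype.ext (mul_inv_cancel₀ hx0))
        rcases B.mem_or_inv_mem (r ⟨x, hx⟩) with h | h
        · exact Or.inl ((hW ⟨x, hx⟩).2 h)
        · refine Or.inr ((hW ⟨x⁻¹, hi⟩).2 ?_)
          rwa [eq_inv_of_mul_eq_one_right hmul]
      · refine Or.inl ((hW ⟨x, hx⟩).2 ?_)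
        rw [hnonunit ⟨x, hx⟩ hi]
        exact B.zero_mem
    intro x hx0
    rcases hV x hx0 with h | h
    · exact key x h
    · simpa [or_comm] using key _ h
  · intro x hx
    rw [memMaxIdeal_iff, memMaxIdeal_iff]
    refine ⟨fun h => ⟨hAW hx, h.2.imp_right fun hi hc => hi ?_⟩,
      fun h => ⟨hx, h.2.imp_right fun hi hc => hi (hAW hc)⟩⟩
    have hx0 : x ≠ 0 := by
      rintro rfl
      exact hi (by simp [A.zero_mem])
    have hu : IsUnit (⟨x, hx⟩ : A) := by
      refine hloc.map_nonunit _ (IsUnit.of_mul_eq_one ⟨r ⟨x⁻¹, hWV hc⟩, (hW ⟨x⁻¹, hWV hc⟩).1 hc⟩ ?_)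
      refine Subtype.ext ?_
      change r ⟨x, hAV hx⟩ * r ⟨x⁻¹, hWV hc⟩ = 1
      rw [← map_mul, ← map_one r]
      exact congrArg r (Subtype.ext (mul_inv_cancel₀ hx0))
    by_contra hni
    exact ((memMaxIdeal_iff A x).2 ⟨hx, Or.inr hni⟩).2 hu

theorem coe_ne_zero_of_notMem {A : Subring F} {P : Ideal A} {b : A} (hb : b ∉ P) :
    (b : F) ≠ 0 := fun h => hb (by rw [show b = 0 from Subtype.ext h]; exact P.zero_mem)

theorem mem_localizationSubring_iff (A : Subring F) (P : Ideal A) [hP : P.IsPrime] (z : F) :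
    z ∈ localizationSubring A P ↔ ∃ a b : A, b ∉ P ∧ z = (a : F) * (b : F)⁻¹ := by
  refine ⟨fun hz => ?_, fun hz => Subring.subset_closure hz⟩
  have h1 : (1 : A) ∉ P := (Ideal.ne_top_iff_one P).1 hP.ne_top
  induction hz using Subring.closure_induction with
  | mem x hx => exact hx
  | zero => exact ⟨0, 1, h1, by simp⟩
  | one => exact ⟨1, 1, h1, by simp⟩
  | add x y _ _ hx hy =>
    obtain ⟨a, b, hb, rfl⟩ := hx
    obtain ⟨c, d, hd, rfl⟩ := hy
    have hb0 := coe_ne_zero_of_notMem hb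
    have hd0 := coe_ne_zero_of_notMem hd
    refine ⟨a * d + c * b, b * d, fun h => (hP.mem_or_mem h).elim hb hd, ?_⟩
    push_cast
    field_simp
  | neg x _ hx =>
    obtain ⟨a, b, hb, rfl⟩ := hx
    exact ⟨-a, b, hb, by simp⟩
  | mul x y _ _ hx hy =>
    obtain ⟨a, b, hb, rfl⟩ := hx
    obtain ⟨c, d, hd, rfl⟩ := hy
    refine ⟨a * c, b * d, fun h => (hP.mem_or_mem h).elim hb hd, ?_⟩
    push_cast
    rw [mul_inv]
    ring

theorem le_localizationSubring (A : Subring F) (P : Ideal A) [hP : P.IsPrime] :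
    A ≤ localizationSubring A P := fun x hx =>
  (mem_localizationSubring_iff A P x).2
    ⟨⟨x, hx⟩, 1, (Ideal.ne_top_iff_one P).1 hP.ne_top, by simp⟩

theorem isLocalRing_localizationSubring (A : Subring F) (P : Ideal A) [hP : P.IsPrime] :
    IsLocalRing (localizationSubring A P) := by
  have key : ∀ a b : A, a ∉ P → b ∉ P → ∀ z : localizationSubring A P,
      (z : F) = a * (b : F)⁻¹ → IsUnit z := by
    intro a b ha hb z hz
    have ha0 := coe_ne_zero_of_notMem ha
    have hb0 := coe_ne_zero_of_notMem hb
    refine IsUnit.of_mul_eq_one ⟨b * (a : F)⁻¹, Subring.subset_closure ⟨b, a, ha, rfl⟩⟩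
      (Subtype.ext ?_)
    change (z : F) * (b * (a : F)⁻¹) = 1
    rw [hz]
    field_simp
  refine IsLocalRing.of_isUnit_or_isUnit_one_sub_self fun z => ?_
  obtain ⟨a, b, hb, hz⟩ := (mem_localizationSubring_iff A P z).1 z.2
  have hb0 := coe_ne_zero_of_notMem hb
  by_cases ha : a ∈ P
  · refine Or.inr (key (b - a) b (fun h => hb ?_) hb _ ?_)
    · simpa using P.add_mem h ha
    · push_cast
      rw [hz]
      field_simp
  · exact Or.inl (key a b ha hb z hz)

theorem le_modelChart (D : Subring F) {n : ℕ} (x : Fin n → F) (i : Fin n) :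
    D ≤ modelChart D x i := fun _ hy => Subring.subset_closure (Or.inl hy)

theorem div_mem_modelChart (D : Subring F) {n : ℕ} (x : Fin n → F) (i j : Fin n) :
    x j * (x i)⁻¹ ∈ modelChart D x i := Subring.subset_closure (Or.inr ⟨j, rfl⟩)

theorem modelChart_le {D R : Subring F} {n : ℕ} {x : Fin n → F} {i : Fin n} (hD : D ≤ R)
    (h : ∀ j, x j * (x i)⁻¹ ∈ R) : modelChart D x i ≤ R := by
  refine Subring.closure_le.2 ?_
  rintro _ (hy | ⟨j, rfl⟩)
  exacts [hD hy, h j]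

namespace IsProjModel

variable {D : Subring F} {X : Set (Subring F)}

theorem isLocalRing (hX : IsProjModel D X) {α : Subring F} (hα : α ∈ X) : IsLocalRing α := by
  obtain ⟨n, x, hx, rfl⟩ := hX
  obtain ⟨i, P, hP, rfl⟩ := hα
  exact isLocalRing_localizationSubring _ P

theorem le (hX : IsProjModel D X) {α : Subring F} (hα : α ∈ X) : D ≤ α := by
  obtain ⟨n, x, hx, rfl⟩ := hX
  obtain ⟨i, P, hP, rfl⟩ := hα
  exact (le_modelChart D x i).trans (le_localizationSubring _ P)

/-- Members of a projective model have arbitrarily small basic neighborhoods `U(t)` such that a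
ring dominating a member `γ` of the model contains `t` only if `γ` contains `t`. -/
theorem exists_finset (hX : IsProjModel D X) {α : Subring F} (hα : α ∈ X) (s : Finset F)
    (hs : ∀ z ∈ s, z ∈ α) :
    ∃ t : Finset F, s ⊆ t ∧ (∀ z ∈ t, z ∈ α) ∧
      ∀ V γ : Subring F, γ ∈ X → Dominates V γ → (∀ z ∈ t, z ∈ V) → ∀ z ∈ t, z ∈ γ := by
  classical
  have hX' := hX
  obtain ⟨n, x, hx, rfl⟩ := hX
  obtain ⟨i, P, hP, rfl⟩ := hα
  choose! a b hb hab using fun z hz => (mem_localizationSubring_iff _ P z).1 (hs z hz)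
  let t₀ : Finset F := Finset.univ.image fun j => x j * (x i)⁻¹
  let t₁ : Finset F := s.image fun z => ((b z : F))⁻¹
  refine ⟨s ∪ (t₀ ∪ t₁), Finset.subset_union_left, ?_, ?_⟩
  · intro z hz
    simp only [Finset.mem_union, t₀, t₁, Finset.mem_image, Finset.mem_univ, true_and] at hz
    rcases hz with hz | ⟨j, rfl⟩ | ⟨w, hw, rfl⟩
    · exact hs z hz
    · exact le_localizationSubring _ P (div_mem_modelChart D x i j)
    · exact Subring.subset_closure ⟨1, b w, hb w hw, by simp⟩
  · intro V γ hγ hVγ hV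
    have hDγ := hX'.le hγ
    have h₀ : ∀ j, x j * (x i)⁻¹ ∈ V := fun j => hV _ (by
      simp only [Finset.mem_union, t₀, Finset.mem_image]
      exact Or.inr (Or.inl ⟨j, Finset.mem_univ j, rfl⟩))
    have h₁ : ∀ w ∈ s, (b w : F)⁻¹ ∈ V := fun w hw => hV _ (by
      simp only [Finset.mem_union, t₁, Finset.mem_image]
      exact Or.inr (Or.inr ⟨w, hw, rfl⟩))
    have h₂ : ∀ j, x j * (x i)⁻¹ ∈ γ := by
      obtain ⟨k, Q, hQ, rfl⟩ := hγ
      have hc := fun j => le_localizationSubring _ Q (div_mem_modelChart D x k j)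
      have hki : x k * (x i)⁻¹ = (x i * (x k)⁻¹)⁻¹ := by rw [mul_inv, inv_inv, mul_comm]
      have h := hVγ.inv_mem (hc i) (hki ▸ h₀ k)
      intro j
      have := mul_mem (hc j) h
      rwa [← hki, mul_assoc, inv_mul_cancel_left₀ (hx k)] at this
    have h₃ := modelChart_le hDγ h₂
    have h₄ : ∀ w ∈ s, (b w : F)⁻¹ ∈ γ := fun w hw =>
      hVγ.inv_mem (h₃ (b w).2) (h₁ w hw)
    intro z hz
    simp only [Finset.mem_union, t₀, t₁, Finset.mem_image, Finset.mem_univ, true_and] at hz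
    rcases hz with hz | ⟨j, rfl⟩ | ⟨w, hw, rfl⟩
    · rw [hab z hz]
      exact mul_mem (h₃ (a z).2) (h₄ z hz)
    · exact h₂ j
    · exact h₄ w hw

theorem le_of_dominates (hX : IsProjModel D X) {V α γ : Subring F} (hα : α ∈ X) (hγ : γ ∈ X)
    (hVα : α ≤ V) (hVγ : Dominates V γ) : α ≤ γ := by
  intro z hz
  obtain ⟨t, hst, htα, ht⟩ := hX.exists_finset hα {z} (by simpa using hz)
  exact ht V γ hγ hVγ (fun w hw => hVα (htα w hw)) z (hst (by simp))

theorem eq_of_dominates (hX : IsProjModel D X) {V α γ : Subring F} (hα : α ∈ X) (hγ : γ ∈ X)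
    (hVα : Dominates V α) (hVγ : Dominates V γ) : α = γ :=
  le_antisymm (hX.le_of_dominates hα hγ hVα.1 hVγ) (hX.le_of_dominates hγ hα hVγ.1 hVα)

end IsProjModel

theorem zariskiTop_isOpen_basic (X : Set (Subring F)) (s : Finset F) :
    IsOpen[zariskiTop X] {R : X | ∀ x ∈ s, x ∈ (R : Subring F)} :=
  TopologicalSpace.isOpen_generateFrom_of_mem ⟨s, rfl⟩

theorem zariskiTop_exists_basic {X : Set (Subring F)} {U : Set X} (hU : IsOpen[zariskiTop X] U)
    {α : X} (hα : α ∈ U) :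
    ∃ s : Finset F, (∀ x ∈ s, x ∈ (α : Subring F)) ∧
      ∀ β : X, (∀ x ∈ s, x ∈ (β : Subring F)) → β ∈ U := by
  classical
  induction hU with
  | basic U hU =>
    obtain ⟨s, rfl⟩ := hU
    exact ⟨s, hα, fun _ h => h⟩
  | univ => exact ⟨∅, by simp, fun _ _ => trivial⟩
  | inter U V _ _ hU hV =>
    obtain ⟨s, hs, hsU⟩ := hU hα.1
    obtain ⟨t, ht, htV⟩ := hV hα.2
    refine ⟨s ∪ t, fun x hx => (Finset.mem_union.1 hx).elim (hs x) (ht x), fun β hβ =>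
      ⟨hsU β fun x hx => hβ x (Finset.mem_union_left _ hx),
        htV β fun x hx => hβ x (Finset.mem_union_right _ hx)⟩⟩
  | sUnion S _ hS =>
    obtain ⟨U, hUS, hαU⟩ := hα
    obtain ⟨s, hs, hsU⟩ := hS U hUS hαU
    exact ⟨s, hs, fun β hβ => ⟨U, hUS, hsU β hβ⟩⟩

/-- The topology on a collection of subrings of `F` making all the sets
`{R | x ∈ R}` with `x ∈ F` clopen. -/
abbrev constructibleTop (X : Set (Subring F)) : TopologicalSpace X :=
  TopologicalSpace.generateFrom
    {U | ∃ x : F, U = {R : X | x ∈ (R : Subring F)} ∨ U = {R : X | x ∈ (R : Subring F)}ᶜ}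

theorem constructibleTop_isClopen (X : Set (Subring F)) (s : Finset F) :
    @IsClopen _ (constructibleTop X) {R : X | ∀ x ∈ s, x ∈ (R : Subring F)} := by
  let _ := constructibleTop X
  have h : {R : X | ∀ x ∈ s, x ∈ (R : Subring F)} = ⋂ x ∈ s, {R : X | x ∈ (R : Subring F)} := by
    ext; simp
  rw [h]
  refine isClopen_biInter_finset fun x _ => ⟨⟨?_⟩, ?_⟩
  · exact TopologicalSpace.isOpen_generateFrom_of_mem ⟨x, Or.inr rfl⟩
  · exact TopologicalSpace.isOpen_generateFrom_of_mem ⟨x, Or.inl rfl⟩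

theorem constructibleTop_le_zariskiTop (X : Set (Subring F)) :
    constructibleTop X ≤ zariskiTop X := by
  refine le_generateFrom ?_
  rintro _ ⟨s, rfl⟩
  exact (constructibleTop_isClopen X s).2

theorem compactSpace_constructibleTop_zarSet (D : Subring F) :
    @CompactSpace _ (constructibleTop (zarSet D)) := by
  let _ := constructibleTop (zarSet D)
  refine ⟨isCompact_iff_ultrafilter_le_nhds.2 fun f _ => ?_⟩
  let W : Subring F :=
    { carrier := {x | ∀ᶠ R : zarSet D in f, x ∈ (R : Subring F)}
      mul_mem' := fun hx hy => by
        filter_upwards [hx, hy] with R h₁ h₂ using mul_mem h₁ h₂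
      one_mem' := Filter.Eventually.of_forall fun R => one_mem _
      add_mem' := fun hx hy => by
        filter_upwards [hx, hy] with R h₁ h₂ using add_mem h₁ h₂
      zero_mem' := Filter.Eventually.of_forall fun R => zero_mem _
      neg_mem' := fun hx => by
        filter_upwards [hx] with R h using neg_mem h }
  have hW : W ∈ zarSet D := by
    refine ⟨fun x hx => ?_, fun x hx => Filter.Eventually.of_forall fun R => R.2.2 hx⟩
    exact Ultrafilter.eventually_or.1 (Filter.Eventually.of_forall fun R => R.2.1 x hx)
  refine ⟨⟨W, hW⟩, trivial, ?_⟩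
  refine le_of_le_of_eq ?_ TopologicalSpace.nhds_generateFrom.symm
  refine le_iInf₂ ?_
  rintro U ⟨hU, x, rfl | rfl⟩
  · exact Filter.le_principal_iff.2 hU
  · exact Filter.le_principal_iff.2 (Ultrafilter.compl_mem_iff_notMem.2 hU)

namespace IsProjModel

variable {D : Subring F} {X : Set (Subring F)} {d : zarSet D → X}

theorem surjective (hX : IsProjModel D X) (hd : ∀ V : zarSet D, Dominates V.1 (d V).1) :
    Function.Surjective d := by
  intro α
  have := hX.isLocalRing α.2
  obtain ⟨W, hW, -, hWα⟩ := exists_le_dominates (A := α.1) (V := ⊤)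
    (fun _ _ => Or.inl trivial) le_top
  let W' : zarSet D := ⟨W, hW, (hX.le α.2).trans hWα.1⟩
  exact ⟨W', Subtype.ext (hX.eq_of_dominates (d W').2 α.2 (hd W') hWα)⟩

/-- Every Zariski neighborhood of a point of a projective model contains a basic one whose
preimage in `Zar_F(D)` is defined by the same elements. -/
theorem exists_basic (hX : IsProjModel D X) (hd : ∀ V : zarSet D, Dominates V.1 (d V).1)
    {U : Set X} (hU : IsOpen[zariskiTop X] U) {α : X} (hα : α ∈ U) :
    ∃ t : Finset F, (∀ x ∈ t, x ∈ (α : Subring F)) ∧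
      {β : X | ∀ x ∈ t, x ∈ (β : Subring F)} ⊆ U ∧
      d ⁻¹' {β : X | ∀ x ∈ t, x ∈ (β : Subring F)} =
        {V : zarSet D | ∀ x ∈ t, x ∈ (V : Subring F)} := by
  obtain ⟨s, hs, hsU⟩ := zariskiTop_exists_basic hU hα
  obtain ⟨t, hst, htα, ht⟩ := hX.exists_finset α.2 s hs
  refine ⟨t, htα, fun β hβ => hsU β fun x hx => hβ x (hst hx), ?_⟩
  ext V
  exact ⟨fun h x hx => (hd V).1 (h x hx), fun h => ht V.1 (d V).1 (d V).2 (hd V) h⟩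

theorem continuous_zariski (hX : IsProjModel D X)
    (hd : ∀ V : zarSet D, Dominates V.1 (d V).1) :
    Continuous[zariskiTop (zarSet D), zariskiTop X] d := by
  let _ := zariskiTop (zarSet D)
  let _ := zariskiTop X
  refine ⟨fun U hU => isOpen_iff_forall_mem_open.2 fun V hV => ?_⟩
  obtain ⟨t, htα, htU, ht⟩ := hX.exists_basic hd hU hV
  refine ⟨_, Set.preimage_mono htU, ?_, htα⟩
  rw [ht]
  exact zariskiTop_isOpen_basic _ t

theorem isClosedMap_zariski (hX : IsProjModel D X)
    (hd : ∀ V : zarSet D, Dominates V.1 (d V).1) :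
    @IsClosedMap _ _ (zariskiTop (zarSet D)) (zariskiTop X) d := by
  classical
  intro K hK
  have hKc : IsClosed[constructibleTop (zarSet D)] K :=
    IsClosed.mono hK (constructibleTop_le_zariskiTop _)
  have hex : ∀ α : X, α ∈ @closure _ (zariskiTop X) (d '' K) → ∃ V ∈ K, α.1 ≤ V.1 := by
    intro α hα
    let _ := constructibleTop (zarSet D)
    have := compactSpace_constructibleTop_zarSet D
    by_contra! hc
    let N : F → Set (zarSet D) := fun x => {V | x ∈ (V : Subring F)}
    have hN : ∀ x : α.1, IsClosed (N x) := fun x => by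
      simpa [N] using (constructibleTop_isClopen (zarSet D) {x.1}).1
    obtain ⟨u, hu⟩ := hKc.isCompact.elim_finite_subfamily_closed (fun x : α.1 => N x) hN (by
      refine Set.eq_empty_of_forall_notMem fun V hV => hc V hV.1 fun x hx => ?_
      exact Set.mem_iInter.1 hV.2 ⟨x, hx⟩)
    have hopen := zariskiTop_isOpen_basic X (u.image Subtype.val)
    obtain ⟨_, hβ, V, hVK, rfl⟩ := (@mem_closure_iff _ (zariskiTop X) _ _).1 hα _ hopen (by
      intro x hx
      obtain ⟨y, -, rfl⟩ := Finset.mem_image.1 hx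
      exact y.2)
    refine Set.notMem_empty V (hu ▸ ⟨hVK, Set.mem_iInter₂.2 fun x hx => ?_⟩)
    exact (hd V).1 (hβ x (Finset.mem_image_of_mem _ hx))
  refine @isClosed_of_closure_subset _ (zariskiTop X) _ fun α hα => ?_
  obtain ⟨V, hVK, hαV⟩ := hex α hα
  have := hX.isLocalRing α.2
  obtain ⟨W, hW, hWV, hWα⟩ := exists_le_dominates V.2.1 hαV
  let W' : zarSet D := ⟨W, hW, (hX.le α.2).trans hWα.1⟩
  refine ⟨W', ?_, Subtype.ext (hX.eq_of_dominates (d W').2 α.2 (hd W') hWα)⟩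
  by_contra hWK
  obtain ⟨s, hs, hsK⟩ := zariskiTop_exists_basic hK.isOpen_compl hWK
  exact hsK V (fun x hx => hWV (hs x hx)) hVK

theorem isCompact_basic (hX : IsProjModel D X) (hd : ∀ V : zarSet D, Dominates V.1 (d V).1)
    {t : Finset F} (ht : d ⁻¹' {β : X | ∀ x ∈ t, x ∈ (β : Subring F)} =
        {V : zarSet D | ∀ x ∈ t, x ∈ (V : Subring F)}) :
    @IsCompact _ (zariskiTop X) {β : X | ∀ x ∈ t, x ∈ (β : Subring F)} := by
  let _ := constructibleTop (zarSet D)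
  have := compactSpace_constructibleTop_zarSet D
  let _ := zariskiTop X
  rw [← Set.image_preimage_eq {β : X | ∀ x ∈ t, x ∈ (β : Subring F)} (hX.surjective hd), ht]
  exact (constructibleTop_isClopen _ t).1.isCompact.image
    (continuous_le_dom (constructibleTop_le_zariskiTop _) (hX.continuous_zariski hd))

theorem isClopen_preimage (hX : IsProjModel D X) (hd : ∀ V : zarSet D, Dominates V.1 (d V).1)
    {U : Set X} (hU : IsOpen[zariskiTop X] U) (hUc : @IsCompact _ (zariskiTop X) U) :
    @IsClopen _ (constructibleTop (zarSet D)) (d ⁻¹' U) := by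
  let _ := constructibleTop (zarSet D)
  let _ := zariskiTop X
  choose t htα htU ht using fun α : U => hX.exists_basic hd hU α.2
  obtain ⟨u, hu⟩ := hUc.elim_finite_subcover
    (fun α : U => {β : X | ∀ x ∈ t α, x ∈ (β : Subring F)})
    (fun α => zariskiTop_isOpen_basic X (t α))
    (fun α hα => Set.mem_iUnion.2 ⟨⟨α, hα⟩, htα _⟩)
  have hU' : U = ⋃ α ∈ u, {β : X | ∀ x ∈ t α, x ∈ (β : Subring F)} :=
    hu.antisymm (Set.iUnion₂_subset fun α _ => htU α)
  rw [hU', Set.preimage_iUnion₂]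
  refine isClopen_biUnion_finset fun α _ => ?_
  rw [ht]
  exact constructibleTop_isClopen _ (t α)

theorem continuous_patch (hX : IsProjModel D X)
    (hd : ∀ V : zarSet D, Dominates V.1 (d V).1) :
    Continuous[constructibleTop (zarSet D), patchTop X] d := by
  let _ := constructibleTop (zarSet D)
  refine continuous_generateFrom_iff.2 ?_
  rintro U (⟨hU, hUc⟩ | ⟨U, hU, hUc, rfl⟩)
  · exact (hX.isClopen_preimage hd hU hUc).2
  · exact (hX.isClopen_preimage hd hU hUc).1.isOpen_compl

theorem t2Space_patch (hX : IsProjModel D X)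
    (hd : ∀ V : zarSet D, Dominates V.1 (d V).1) : @T2Space _ (patchTop X) := by
  let _ := patchTop X
  have key : ∀ α β : X, ¬ α.1 ≤ β.1 → ∃ U : Set X, IsClopen U ∧ α ∈ U ∧ β ∉ U := by
    intro α β h
    obtain ⟨z, hzα, hzβ⟩ := SetLike.not_le_iff_exists.1 h
    obtain ⟨t, htα, htU, ht⟩ := hX.exists_basic hd (zariskiTop_isOpen_basic X {z}) (α := α)
      (by simpa using hzα)
    have ho := zariskiTop_isOpen_basic X t
    have hc := hX.isCompact_basic hd ht
    refine ⟨{γ : X | ∀ x ∈ t, x ∈ (γ : Subring F)}, ⟨⟨?_⟩, ?_⟩, htα,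
      fun hβ => hzβ (htU hβ z (by simp))⟩
    · exact TopologicalSpace.isOpen_generateFrom_of_mem (Or.inr ⟨_, ho, hc, rfl⟩)
    · exact TopologicalSpace.isOpen_generateFrom_of_mem (Or.inl ⟨ho, hc⟩)
  refine ⟨fun α β hαβ => ?_⟩
  by_cases h : α.1 ≤ β.1
  · obtain ⟨U, hU, hβ, hα⟩ := key β α fun h' => hαβ (Subtype.ext (le_antisymm h h'))
    exact ⟨Uᶜ, U, hU.1.isOpen_compl, hU.2, hα, hβ, disjoint_compl_left⟩
  · obtain ⟨U, hU, hα, hβ⟩ := key α β h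
    exact ⟨U, Uᶜ, hU.2, hU.1.isOpen_compl, hα, hβ, disjoint_compl_right⟩

end IsProjModel

/-- If the projective model `Y` of `F/D` dominates the projective model `X`, then the
map `d_{Y,X} : Y → X`, sending a member of `Y` to the unique member of `X` it
dominates, is surjective, continuous and closed in both the Zariski and patch
topologies, and `d_{Y,X} ∘ d_Y = d_X`. -/
theorem statement4 (D : Subring F) (X Y : Set (Subring F))
    (hX : IsProjModel D X) (hY : IsProjModel D Y)
    (hdom : ∀ β ∈ Y, ∃ α ∈ X, Dominates β α)
    (dYX : ↥Y → ↥X) (hdYX : ∀ β : ↥Y, Dominates β.1 (dYX β).1)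
    (dX : ↥(zarSet D) → ↥X) (hdX : ∀ V : ↥(zarSet D), Dominates V.1 (dX V).1)
    (dY : ↥(zarSet D) → ↥Y) (hdY : ∀ V : ↥(zarSet D), Dominates V.1 (dY V).1) :
    Function.Surjective dYX ∧
    @Continuous _ _ (zariskiTop Y) (zariskiTop X) dYX ∧
    @IsClosedMap _ _ (zariskiTop Y) (zariskiTop X) dYX ∧
    @Continuous _ _ (patchTop Y) (patchTop X) dYX ∧
    @IsClosedMap _ _ (patchTop Y) (patchTop X) dYX ∧
    ∀ V : ↥(zarSet D), dYX (dY V) = dX V := by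
  have hcomp : ∀ V : ↥(zarSet D), dYX (dY V) = dX V := fun V =>
    Subtype.ext (hX.eq_of_dominates (dYX (dY V)).2 (dX V).2
      ((hdY V).trans (hdYX (dY V))) (hdX V))
  have hfun : dYX ∘ dY = dX := funext hcomp
  have hsY := hY.surjective hdY
  have hP : @Continuous _ _ (patchTop Y) (patchTop X) dYX := by
    let _ := constructibleTop (zarSet D)
    have := compactSpace_constructibleTop_zarSet D
    let _ := patchTop Y
    let _ := patchTop X
    have := hY.t2Space_patch hdY
    have hc := hY.continuous_patch hdY
    rw [(hc.isClosedMap.isQuotientMap hc hsY).continuous_iff, hfun]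
    exact hX.continuous_patch hdX
  refine ⟨?_, ?_, ?_, hP, ?_, hcomp⟩
  · exact .of_comp (g := dY) (hfun ▸ hX.surjective hdX)
  · let _ := zariskiTop (zarSet D)
    let _ := zariskiTop Y
    let _ := zariskiTop X
    rw [((hY.isClosedMap_zariski hdY).isQuotientMap (hY.continuous_zariski hdY)
      hsY).continuous_iff, hfun]
    exact hX.continuous_zariski hdX
  · let _ := zariskiTop (zarSet D)
    let _ := zariskiTop Y
    let _ := zariskiTop X
    intro C hC
    rw [← Set.image_preimage_eq C hsY, ← Set.image_comp, hfun]
    exact hX.isClosedMap_zariski hdX _ (hC.preimage (hY.continuous_zariski hdY))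
  · let _ := constructibleTop (zarSet D)
    have := compactSpace_constructibleTop_zarSet D
    let _ := patchTop Y
    let _ := patchTop X
    have := hX.t2Space_patch hdX
    have : CompactSpace Y := hsY.compactSpace (hY.continuous_patch hdY)
    exact hP.isClosedMap
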